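/- Let d ≥ 3 and L ≥ 1 be integers, let 0 ≤ k ≤ L−1, let w be a vertex at depth k of the finite d-regular tree of depth L+1, let c₁ ≠ c₂ be two children of w, and let 1 ≤ j ≤ L−k be an integer; set α = j·π/(L+1−k). Define the vector v on interior vertices by: v(u) = (d−1)^{−n/2}·sin((L+1−n)·α) if u is a depth-n descendant of c₁ (including c₁ itself), v(u) = −(d−1)^{−n/2}·sin((L+1−n)·α) if u is a depth-n descendant of c₂ (including c₂ itself), and v(u) = 0 for all other interior vertices u. Then v ≠ 0 and 𝓛_D v = λ·v with λ = 1 − (2/d)·√(d−1)·cos(j·π/(L+1−k)). -/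

import Mathlib

open scoped Classical

/-- Vertices of the finite (truncated) `d`-regular tree whose leaves are at depth `R`:
a vertex at depth `n ≤ R` is encoded by its depth together with its path from the root,
with an entry in `Fin d` at step `0` (the root has `d` children) and entries `< d − 1`
at steps `1, …, n−1` (each deeper non-leaf vertex has `d − 1` children, hence degree `d`);
entries at steps `≥ n` are padded by `0`. -/
abbrev TreeVertex (d R : ℕ) : Type :=
  { p : Fin (R + 1) × (Fin R → Fin d) //
      (∀ i : Fin R, p.1.1 ≤ i.1 → (p.2 i : ℕ) = 0) ∧
      (∀ i : Fin R, 0 < i.1 → i.1 < p.1.1 → (p.2 i : ℕ) < d - 1) }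

namespace TreeVertex

/-- The depth of a vertex. -/
def depth {d R : ℕ} (v : TreeVertex d R) : ℕ := v.1.1.1

/-- `ChildOf u v` means `v` is a child of `u`. -/
def ChildOf {d R : ℕ} (u v : TreeVertex d R) : Prop :=
  v.depth = u.depth + 1 ∧ ∀ i : Fin R, i.1 < u.depth → v.1.2 i = u.1.2 i

/-- `Desc u v` means `v` is a descendant of `u` (including `u` itself). -/
def Desc {d R : ℕ} (u v : TreeVertex d R) : Prop :=
  u.depth ≤ v.depth ∧ ∀ i : Fin R, i.1 < u.depth → v.1.2 i = u.1.2 i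

/-- The root of the tree (for `d > 0`). -/
def root (d R : ℕ) (hd : 0 < d) : TreeVertex d R :=
  ⟨(0, fun _ => ⟨0, hd⟩), fun _ _ => rfl, fun i _ h => absurd h (by simp)⟩

/-- Two vertices are adjacent iff one is a child of the other. -/
def Adj {d R : ℕ} (u v : TreeVertex d R) : Prop := ChildOf u v ∨ ChildOf v u

/-- The interior vertices: those of depth `< R`, i.e. the non-leaves. -/
abbrev Interior (d R : ℕ) : Type := { v : TreeVertex d R // v.depth < R }

end TreeVertex

open TreeVertex

/-- The Dirichlet Laplacian `𝓛_D` of the finite `d`-regular tree of depth `L+1`: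
the normalized Laplacian (every interior vertex has degree `d`) restricted to the rows
and columns of the interior vertices, i.e. with the leaves (depth `L+1`) deleted:
diagonal entries `1` and entry `−1/d` between adjacent interior vertices. -/
noncomputable def dirichletLaplacian (d L : ℕ) :
    Matrix (Interior d (L + 1)) (Interior d (L + 1)) ℝ := fun u v =>
  if u = v then 1 else if Adj u.1 v.1 then -(1 / (d : ℝ)) else 0

namespace TreeVertex

variable {d R : ℕ}

theorem ext_of_depth {x y : TreeVertex d R} (h : x.depth = y.depth)
    (hxy : ∀ i : Fin R, i.1 < x.depth → x.1.2 i = y.1.2 i) : x = y := by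
  refine Subtype.ext (Prod.ext (Fin.ext h) (funext fun i => ?_))
  by_cases hi : i.1 < x.depth
  · exact hxy i hi
  · have hx := x.2.1 i (not_lt.mp hi)
    have hy := y.2.1 i (show y.depth ≤ i.1 by omega)
    exact Fin.ext (hx.trans hy.symm)

theorem ChildOf.parent_unique {p q u : TreeVertex d R} (hp : ChildOf p u) (hq : ChildOf q u) :
    p = q := by
  have h1 := hp.1
  have h2 := hq.1
  refine ext_of_depth (by omega) fun i hi => ?_
  rw [← hp.2 i hi, ← hq.2 i (by omega)]

theorem exists_parent {u : TreeVertex d R} (hu : 0 < u.depth) : ∃ p, ChildOf p u := by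
  have hR : u.depth < R + 1 := u.1.1.2
  have hd : 0 < d := (u.1.2 ⟨0, by omega⟩).pos
  refine ⟨⟨(⟨u.depth - 1, by omega⟩,
    fun i => if i.1 < u.depth - 1 then u.1.2 i else ⟨0, hd⟩), ?_, ?_⟩, ?_, ?_⟩
  · intro i hi
    simp only at hi
    simp [not_lt.mpr hi]
  · intro i hi0 hi
    simp only at hi
    have hlt : i.1 < u.1.1.1 := by unfold depth at hi; omega
    simpa [hi] using u.2.2 i hi0 hlt
  · change u.depth = u.depth - 1 + 1
    omega
  · intro i hi
    change i.1 < u.depth - 1 at hi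
    simp [hi]

theorem card_children {u : TreeVertex d R} (h0 : 0 < u.depth) (hR : u.depth < R) :
    (Finset.univ.filter fun x => ChildOf u x).card = d - 1 := by
  refine (Finset.card_bij (t := Finset.range (d - 1)) (fun x _ => (x.1.2 ⟨u.depth, hR⟩ : ℕ))
    ?_ ?_ ?_).trans (Finset.card_range _)
  · intro x hx
    have hx' := (Finset.mem_filter.mp hx).2
    refine Finset.mem_range.mpr (x.2.2 _ h0 ?_)
    have := hx'.1
    change u.depth < x.depth
    omega
  · intro x hx y hy hxy
    have hx' := (Finset.mem_filter.mp hx).2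
    have hy' := (Finset.mem_filter.mp hy).2
    refine ext_of_depth (hx'.1.trans hy'.1.symm) fun i hi => ?_
    rw [hx'.1] at hi
    rcases Nat.lt_succ_iff_lt_or_eq.mp hi with hlt | heq
    · rw [hx'.2 i hlt, hy'.2 i hlt]
    · have : i = ⟨u.depth, hR⟩ := Fin.ext heq
      rw [this]
      exact Fin.ext hxy
  · intro a ha
    have ha := Finset.mem_range.mp ha
    refine ⟨⟨(⟨u.depth + 1, by omega⟩,
      fun i => if i.1 = u.depth then ⟨a, by omega⟩ else u.1.2 i), ?_, ?_⟩, ?_, ?_⟩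
    · intro i hi
      simp only at hi
      have hne : i.1 ≠ u.depth := by omega
      simpa [hne] using u.2.1 i (show u.depth ≤ i.1 by omega)
    · intro i hi0 hi
      simp only at hi
      by_cases he : i.1 = u.depth
      · simpa [he] using ha
      · simpa [he] using u.2.2 i hi0 (show i.1 < u.depth by omega)
    · refine Finset.mem_filter.mpr ⟨Finset.mem_univ _, rfl, fun i hi => ?_⟩
      simp [hi.ne]
    · simp

theorem Desc.child {c u x : TreeVertex d R} (h : Desc c u) (hx : ChildOf u x) : Desc c x := by
  have h1 := h.1
  have h2 := hx.1
  exact ⟨by omega, fun i hi => (hx.2 i (by omega)).trans (h.2 i hi)⟩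

theorem Desc.parent {c u p : TreeVertex d R} (h : Desc c u) (hp : ChildOf p u)
    (hlt : c.depth < u.depth) : Desc c p := by
  have h2 := hp.1
  exact ⟨by omega, fun i hi => (hp.2 i (by omega)).symm.trans (h.2 i hi)⟩

theorem Desc.eq_of_depth {c u : TreeVertex d R} (h : Desc c u) (he : c.depth = u.depth) :
    u = c :=
  ext_of_depth he.symm fun i hi => h.2 i (he ▸ hi)

theorem Desc.eq_of_desc {c₁ c₂ u : TreeVertex d R} (h₁ : Desc c₁ u) (h₂ : Desc c₂ u)
    (he : c₁.depth = c₂.depth) : c₁ = c₂ :=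
  ext_of_depth he fun i hi => (h₁.2 i hi).symm.trans (h₂.2 i (he ▸ hi))

theorem not_adj_self (u : TreeVertex d R) : ¬ Adj u u := by
  rintro (h | h) <;> exact absurd h.1 (by omega)

/-- The neighbours of `u` outside the subtree below `c` see this subtree only through the edge
joining `c` to its parent. -/
theorem Desc.eq_of_adj_of_not_desc {c w u x : TreeVertex d R} (hc : ChildOf w c)
    (hu : ¬ Desc c u) (hux : Adj u x) (hx : Desc c x) : x = c ∧ u = w := by
  rcases hux with h | h
  · have hxc : x = c := by
      refine hx.eq_of_depth (hx.1.antisymm (not_lt.mp fun hlt => hu (hx.parent h hlt)))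
    subst hxc
    exact ⟨rfl, h.parent_unique hc⟩
  · exact absurd (hx.child h) hu

/-- The sum over the neighbours of `u` of a function of the depth supported on the subtree
below `c` and vanishing at the depth of the parent of `c`. -/
theorem sum_adj_desc {c w u : TreeVertex d R} (hc : ChildOf w c) (hR : u.depth < R)
    (f : ℕ → ℝ) (hf : f w.depth = 0) :
    (∑ x : TreeVertex d R, if Adj u x then (if Desc c x then f x.depth else 0) else 0) =
      (if Desc c u then f (u.depth - 1) + ((d - 1 : ℕ) : ℝ) * f (u.depth + 1) else 0) +
        (if u = w then f c.depth else 0) := by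
  have hcw := hc.1
  by_cases hu : Desc c u
  · have h0 : 0 < u.depth := by have := hu.1; omega
    have huw : u ≠ w := by rintro rfl; have := hu.1; omega
    obtain ⟨p, hp⟩ := exists_parent h0
    have hsplit : ∀ x : TreeVertex d R,
        (if Adj u x then (if Desc c x then f x.depth else 0) else 0) =
          (if x = p then f (u.depth - 1) else 0) +
            (if ChildOf u x then f (u.depth + 1) else 0) := by
      intro x
      by_cases hx : ChildOf u x
      · have hxp : x ≠ p := by
          rintro rfl
          have h1 := hx.1
          have h2 := hp.1
          omega
        simp [Adj, hx, hu.child hx, hxp, hx.1]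
      · by_cases hxp : x = p
        · subst hxp
          have hd : x.depth = u.depth - 1 := by have := hp.1; omega
          by_cases hcx : Desc c x
          · simp [Adj, hx, hp, hcx, hd]
          · have hcu : c.depth = u.depth :=
              hu.1.antisymm (not_lt.mp fun hlt => hcx (hu.parent hp hlt))
            have : u.depth - 1 = w.depth := by omega
            simp [hx, hcx, this, hf]
        · have hxu : ¬ ChildOf x u := fun h => hxp (h.parent_unique hp)
          simp [Adj, hx, hxp, hxu]
    rw [Finset.sum_congr rfl fun x _ => hsplit x, Finset.sum_add_distrib, Finset.sum_ite_eq',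
      ← Finset.sum_filter, Finset.sum_const, card_children h0 hR]
    simp [hu, huw]
  · rw [if_neg hu, zero_add]
    by_cases huw : u = w
    · rw [if_pos huw, Finset.sum_eq_single c]
      · have hcc : Desc c c := ⟨le_rfl, fun _ _ => rfl⟩
        have hadj : Adj u c := Or.inl (huw ▸ hc)
        rw [if_pos hadj, if_pos hcc]
      · intro x _ hxc
        by_cases h1 : Adj u x
        · by_cases h2 : Desc c x
          · exact absurd (Desc.eq_of_adj_of_not_desc hc hu h1 h2).1 hxc
          · simp [h2]
        · simp [h1]
      · simp
    · rw [if_neg huw]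
      refine Finset.sum_eq_zero fun x _ => ?_
      by_cases h1 : Adj u x
      · by_cases h2 : Desc c x
        · exact absurd (Desc.eq_of_adj_of_not_desc hc hu h1 h2).2 huw
        · simp [h2]
      · simp [h1]

end TreeVertex

theorem dirichletLaplacian_mulVec_apply (d L : ℕ) (g : TreeVertex d (L + 1) → ℝ)
    (hg : ∀ x : TreeVertex d (L + 1), x.depth = L + 1 → g x = 0) (u : Interior d (L + 1)) :
    (dirichletLaplacian d L).mulVec (fun x => g x.1) u =
      g u.1 - 1 / (d : ℝ) * ∑ x : TreeVertex d (L + 1), if Adj u.1 x then g x else 0 := by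
  have hsum : (∑ x : TreeVertex d (L + 1), if Adj u.1 x then g x else 0) =
      ∑ x : Interior d (L + 1), if Adj u.1 x.1 then g x.1 else 0 := by
    rw [← Finset.sum_subtype (Finset.univ.filter fun x : TreeVertex d (L + 1) => x.depth < L + 1)
      (by simp) (fun x => if Adj u.1 x then g x else 0)]
    refine (Finset.sum_subset (Finset.subset_univ _) fun x _ hx => ?_).symm
    have hlt : x.depth < L + 1 + 1 := x.1.1.2
    have hnot : ¬ x.depth < L + 1 := fun h => hx (Finset.mem_filter.mpr ⟨Finset.mem_univ _, h⟩)
    simp [hg x (by omega)]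
  have hterm : ∀ x : Interior d (L + 1), dirichletLaplacian d L u x * g x.1 =
      (if u = x then g x.1 else 0) - 1 / (d : ℝ) * (if Adj u.1 x.1 then g x.1 else 0) := by
    intro x
    unfold dirichletLaplacian
    by_cases hux : u = x
    · subst hux
      simp [not_adj_self]
    · by_cases h : Adj u.1 x.1 <;> simp [hux, h]
  rw [hsum]
  simp only [Matrix.mulVec, dotProduct]
  rw [Finset.sum_congr rfl fun x _ => hterm x, Finset.sum_sub_distrib, ← Finset.mul_sum]
  simp

/-- The three-term recurrence satisfied by `n ↦ q ^ (-n / 2) * sin ((M - n) * α)`. -/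
theorem rpow_mul_sin_recurrence {q : ℝ} (hq : 0 < q) (M α t : ℝ) :
    q ^ (-(t - 1) / 2) * Real.sin ((M - (t - 1)) * α) +
        q * (q ^ (-(t + 1) / 2) * Real.sin ((M - (t + 1)) * α)) =
      2 * Real.sqrt q * Real.cos α * (q ^ (-t / 2) * Real.sin ((M - t) * α)) := by
  have h1 : q ^ (-(t - 1) / 2) = q ^ (-t / 2) * Real.sqrt q := by
    rw [Real.sqrt_eq_rpow, ← Real.rpow_add hq]
    ring_nf
  have h2 : q * q ^ (-(t + 1) / 2) = q ^ (-t / 2) * Real.sqrt q := by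
    nth_rewrite 1 [← Real.rpow_one q]
    rw [Real.sqrt_eq_rpow, ← Real.rpow_add hq, ← Real.rpow_add hq]
    ring_nf
  have h3 : (M - (t - 1)) * α = (M - t) * α + α := by ring
  have h4 : (M - (t + 1)) * α = (M - t) * α - α := by ring
  rw [← mul_assoc, h2, h1, h3, h4, Real.sin_add, Real.sin_sub]
  ring

/-- Let `d ≥ 3`, `L ≥ 1`, `0 ≤ k ≤ L−1`, let `w` be a vertex at depth
`k`, let `c₁ ≠ c₂` be two children of `w`, let `1 ≤ j ≤ L−k` and `α = jπ/(L+1−k)`.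
The vector which equals `(d−1)^{−n/2}·sin((L+1−n)·α)` on depth-`n` descendants of `c₁`,
the negative of that on depth-`n` descendants of `c₂`, and `0` elsewhere, is nonzero
and satisfies `𝓛_D v = λ·v` with `λ = 1 − (2/d)·√(d−1)·cos(jπ/(L+1−k))`. -/
theorem sector_dirichlet_eigenvector (d L : ℕ) (hd : 3 ≤ d) (hL : 1 ≤ L)
    (k : ℕ) (hk : k ≤ L - 1) (w : TreeVertex d (L + 1)) (hw : w.depth = k)
    (c₁ c₂ : TreeVertex d (L + 1)) (hc₁ : ChildOf w c₁) (hc₂ : ChildOf w c₂)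
    (hne : c₁ ≠ c₂) (j : ℕ) (hj₁ : 1 ≤ j) (hj₂ : j ≤ L - k) :
    let α : ℝ := (j : ℝ) * Real.pi / ((L : ℝ) + 1 - (k : ℝ))
    let v : Interior d (L + 1) → ℝ := fun u =>
      if Desc c₁ u.1 then
        ((d : ℝ) - 1) ^ (-(u.1.depth : ℝ) / 2)
          * Real.sin (((L : ℝ) + 1 - (u.1.depth : ℝ)) * α)
      else if Desc c₂ u.1 then
        -(((d : ℝ) - 1) ^ (-(u.1.depth : ℝ) / 2)
          * Real.sin (((L : ℝ) + 1 - (u.1.depth : ℝ)) * α))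
      else 0
    v ≠ 0 ∧ (dirichletLaplacian d L).mulVec v
        = (1 - (2 / (d : ℝ)) * Real.sqrt ((d : ℝ) - 1) * Real.cos α) • v := by
  intro α v
  have hdR : (3 : ℝ) ≤ d := by exact_mod_cast hd
  have hq : (0 : ℝ) < (d : ℝ) - 1 := by linarith
  have hjk : (j : ℝ) + k ≤ L := by
    have : j + k ≤ L := by omega
    exact_mod_cast this
  have hj : (1 : ℝ) ≤ j := by exact_mod_cast hj₁
  have hM : (0 : ℝ) < (L : ℝ) + 1 - k := by linarith
  have hα : ((L : ℝ) + 1 - k) * α = j * Real.pi := by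
    simp only [α]
    field_simp
  have hα0 : 0 < α := by positivity
  have hαπ : α < Real.pi := by
    rw [div_lt_iff₀ hM]
    nlinarith [Real.pi_pos]
  have hd₁ : c₁.depth = k + 1 := hw ▸ hc₁.1
  have hd₂ : c₂.depth = k + 1 := hw ▸ hc₂.1
  let f : ℕ → ℝ := fun n =>
    ((d : ℝ) - 1) ^ (-(n : ℝ) / 2) * Real.sin (((L : ℝ) + 1 - (n : ℝ)) * α)
  let h : TreeVertex d (L + 1) → TreeVertex d (L + 1) → ℝ := fun c x =>
    if Desc c x then f x.depth else 0
  have hfw : f w.depth = 0 := by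
    simp only [f, hw, hα, Real.sin_nat_mul_pi, mul_zero]
  have hfL : f (L + 1) = 0 := by simp [f]
  have hv : v = fun u => h c₁ u.1 - h c₂ u.1 := by
    funext u
    simp only [v, h, f]
    by_cases h₁ : Desc c₁ u.1
    · have h₂ : ¬ Desc c₂ u.1 := fun h₂ => hne (h₁.eq_of_desc h₂ (hd₁.trans hd₂.symm))
      simp [h₁, h₂]
    · by_cases h₂ : Desc c₂ u.1 <;> simp [h₁, h₂]
  have hsum : ∀ c, ChildOf w c → ∀ u : Interior d (L + 1),
      (∑ x : TreeVertex d (L + 1), if Adj u.1 x then h c x else 0) =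
        2 * Real.sqrt ((d : ℝ) - 1) * Real.cos α * h c u.1 +
          if u.1 = w then f (k + 1) else 0 := by
    intro c hc u
    have hcd : c.depth = k + 1 := hw ▸ hc.1
    rw [sum_adj_desc hc u.2 f hfw, hcd]
    congr 1
    by_cases hcu : Desc c u.1
    · have h1 : 1 ≤ u.1.depth := by have := hcu.1; omega
      simp only [h, hcu, if_true, f]
      push_cast [Nat.cast_sub h1, Nat.cast_sub (show 1 ≤ d by omega)]
      exact rpow_mul_sin_recurrence hq _ α _
    · simp [h, hcu]
  refine ⟨fun hv0 => ?_, ?_⟩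
  · have hc := congrFun hv0 ⟨c₁, by omega⟩
    have hcc : Desc c₁ c₁ := ⟨le_rfl, fun _ _ => rfl⟩
    simp only [v, hcc, if_true, Pi.zero_apply] at hc
    rcases mul_eq_zero.mp hc with hc | hc
    · exact (Real.rpow_pos_of_pos hq _).ne' hc
    · have harg : ((L : ℝ) + 1 - (c₁.depth : ℝ)) * α = j * Real.pi - α := by
        rw [hd₁, ← hα]
        push_cast
        ring
      rw [harg, Real.sin_nat_mul_pi_sub] at hc
      have hsin := (Real.sin_pos_of_pos_of_lt_pi hα0 hαπ).ne'
      simp [hsin] at hc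
  · have hleaf : ∀ x : TreeVertex d (L + 1), x.depth = L + 1 → h c₁ x - h c₂ x = 0 := by
      intro x hx
      simp [h, hx, hfL]
    rw [hv]
    funext u
    rw [dirichletLaplacian_mulVec_apply d L (fun x => h c₁ x - h c₂ x) hleaf u]
    have hsub : (∑ x : TreeVertex d (L + 1), if Adj u.1 x then h c₁ x - h c₂ x else 0) =
        (∑ x : TreeVertex d (L + 1), if Adj u.1 x then h c₁ x else 0) -
          ∑ x : TreeVertex d (L + 1), if Adj u.1 x then h c₂ x else 0 := by
      rw [← Finset.sum_sub_distrib]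
      refine Finset.sum_congr rfl fun x _ => ?_
      split_ifs <;> simp
    rw [hsub, hsum c₁ hc₁, hsum c₂ hc₂]
    simp only [Pi.smul_apply, smul_eq_mul]
    ring
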